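/- Let X, Y be finite sets, Θ compact, p(x,y|θ) continuous in θ, and assume every x ∈ X has some θ with p(x|θ)>0. Then there exists a weakly convergent sequence of priors (π_n) with limit π_∞ such that the limit q*(y;x) = lim_n p_{π_n}(y|x) exists, q* is a minimax predictive density under KL risk R, and π_∞ maximizes the conditional mutual information: I_{θ,y|x}(π_∞) = sup_{π∈P} I_{θ,y|x}(π). -/

import Mathlib

open MeasureTheory Filter

noncomputable def negEnt (u : ℝ) : ℝ := u * Real.log u

noncomputable def pMix {Θ X Y : Type*} [MeasurableSpace Θ]
    (p : X → Y → Θ → ℝ) (π : ProbabilityMeasure Θ) (x : X) (y : Y) : ℝ :=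
  ∫ θ, p x y θ ∂(π : Measure Θ)

noncomputable def condMutualInfo {Θ X Y : Type*} [MeasurableSpace Θ] [Fintype X] [Fintype Y]
    (p : X → Y → Θ → ℝ) (π : ProbabilityMeasure Θ) : ℝ :=
  (∫ θ, ∑ x : X, ∑ y : Y, negEnt (p x y θ) ∂(π : Measure Θ))
    - ∑ x : X, ∑ y : Y, negEnt (pMix p π x y)
    - (∫ θ, ∑ x : X, negEnt (∑ y : Y, p x y θ) ∂(π : Measure Θ))
    + ∑ x : X, negEnt (∑ y : Y, pMix p π x y)

def IsPredDensity {X Y : Type*} [Fintype Y] (q : X → Y → ℝ) : Prop :=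
  (∀ x y, 0 ≤ q x y ∧ q x y ≤ 1) ∧ ∀ x, ∑ y : Y, q x y = 1

noncomputable def klTerm (a b c : ℝ) : EReal :=
  if a = 0 then 0 else if c = 0 then ⊤ else ((a * Real.log (b / c) : ℝ) : EReal)

noncomputable def risk {Θ X Y : Type*} [Fintype X] [Fintype Y]
    (p : X → Y → Θ → ℝ) (q : X → Y → ℝ) (θ : Θ) : EReal :=
  ∑ x : X, ∑ y : Y, klTerm (p x y θ) (p x y θ / ∑ y' : Y, p x y' θ) (q x y)

noncomputable def condPred {X Y : Type*} [Fintype Y] (m : X → Y → ℝ) (x : X) (y : Y) : ℝ :=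
  m x y / ∑ y' : Y, m x y'

noncomputable def entGap {Θ X Y : Type*} [Fintype X] [Fintype Y]
    (p : X → Y → Θ → ℝ) (θ : Θ) : ℝ :=
  (∑ x : X, ∑ y : Y, negEnt (p x y θ)) - ∑ x : X, negEnt (∑ y : Y, p x y θ)

/-- The real-valued form of `risk`, valid when `q` charges every pair charged by `p`. -/
noncomputable def logRisk {Θ X Y : Type*} [Fintype X] [Fintype Y]
    (p : X → Y → Θ → ℝ) (q : X → Y → ℝ) (θ : Θ) : ℝ :=
  entGap p θ - ∑ x : X, ∑ y : Y, p x y θ * Real.log (q x y)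

noncomputable def mixture {Θ : Type*} [MeasurableSpace Θ] (t : unitInterval)
    (π ν : ProbabilityMeasure Θ) : ProbabilityMeasure Θ :=
  ⟨ENNReal.ofReal (1 - t) • (π : Measure Θ) + ENNReal.ofReal t • (ν : Measure Θ), ⟨by
    simp only [Measure.coe_add, Measure.coe_smul, Pi.add_apply, Pi.smul_apply, measure_univ,
      smul_eq_mul, mul_one]
    rw [← ENNReal.ofReal_add (sub_nonneg.2 t.2.2) t.2.1, sub_add_cancel, ENNReal.ofReal_one]⟩⟩

lemma continuous_negEnt : Continuous negEnt := Real.continuous_mul_log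

lemma sum_mul_log_add_negEnt_sum_le {Y : Type*} [Fintype Y] (a q : Y → ℝ)
    (ha : ∀ y, 0 ≤ a y) (hq : ∀ y, 0 ≤ q y) (hq1 : ∑ y, q y ≤ 1)
    (hs : ∀ y, a y ≠ 0 → q y ≠ 0) :
    ∑ y, a y * Real.log (q y) + negEnt (∑ y, a y) ≤ ∑ y, negEnt (a y) := by
  set A := ∑ y, a y with hA
  have hA0 : 0 ≤ A := Finset.sum_nonneg fun y _ => ha y
  have key : ∀ y, a y * Real.log (q y) + a y * Real.log A - negEnt (a y) ≤ q y * A - a y := by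
    intro y
    by_cases h : a y = 0
    · simpa [h, negEnt] using mul_nonneg (hq y) hA0
    have h0 : 0 < a y := lt_of_le_of_ne (ha y) (Ne.symm h)
    have hq0 : 0 < q y := lt_of_le_of_ne (hq y) (Ne.symm (hs y h))
    have hAy : 0 < A := h0.trans_le (Finset.single_le_sum (fun y _ => ha y) (Finset.mem_univ y))
    have hlog := Real.log_le_sub_one_of_pos (div_pos (mul_pos hq0 hAy) h0)
    rw [Real.log_div (mul_pos hq0 hAy).ne' h, Real.log_mul hq0.ne' hAy.ne'] at hlog
    have := mul_le_mul_of_nonneg_left hlog h0.le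
    have e : a y * (q y * A / a y - 1) = q y * A - a y := by field_simp
    rw [e] at this
    unfold negEnt
    linarith
  have hsum := Finset.sum_le_sum fun y (_ : y ∈ Finset.univ) => key y
  rw [Finset.sum_sub_distrib, Finset.sum_sub_distrib, Finset.sum_add_distrib, ← Finset.sum_mul,
    ← Finset.sum_mul, ← hA] at hsum
  have : (∑ y, q y) * A ≤ 1 * A := mul_le_mul_of_nonneg_right hq1 hA0
  unfold negEnt at *
  linarith

section Mixture

variable {Θ : Type*} [MetricSpace Θ] [CompactSpace Θ] [MeasurableSpace Θ] [BorelSpace Θ]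

lemma integrable_of_continuous {f : Θ → ℝ} (hf : Continuous f) (π : ProbabilityMeasure Θ) :
    Integrable f (π : Measure Θ) :=
  hf.integrable_of_hasCompactSupport (HasCompactSupport.of_compactSpace f)

lemma integral_mixture {f : Θ → ℝ} (hf : Continuous f) (t : unitInterval)
    (π ν : ProbabilityMeasure Θ) :
    ∫ θ, f θ ∂(mixture t π ν : Measure Θ)
      = (1 - t) * ∫ θ, f θ ∂(π : Measure Θ) + t * ∫ θ, f θ ∂(ν : Measure Θ) := by
  have hm : (mixture t π ν : Measure Θ)
    = ENNReal.ofReal (1 - t) • (π : Measure Θ) + ENNReal.ofReal t • (ν : Measure Θ) := rfl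
  rw [hm, integral_add_measure
      ((integrable_of_continuous hf π).smul_measure ENNReal.ofReal_ne_top)
      ((integrable_of_continuous hf ν).smul_measure ENNReal.ofReal_ne_top),
    integral_smul_measure, integral_smul_measure, ENNReal.toReal_ofReal (sub_nonneg.2 t.2.2),
    ENNReal.toReal_ofReal t.2.1, smul_eq_mul, smul_eq_mul]

lemma continuous_integral {f : Θ → ℝ} (hf : Continuous f) :
    Continuous fun π : ProbabilityMeasure Θ => ∫ θ, f θ ∂(π : Measure Θ) :=
  ProbabilityMeasure.continuous_integral_boundedContinuousFunction
    (BoundedContinuousFunction.mkOfCompact ⟨f, hf⟩)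

lemma continuous_mixture_left (t : unitInterval) (ν : ProbabilityMeasure Θ) :
    Continuous fun π => mixture t π ν := by
  refine continuous_iff_continuousAt.2 fun π => ?_
  refine ProbabilityMeasure.tendsto_iff_forall_integral_tendsto.2 fun f => ?_
  simp_rw [integral_mixture f.continuous]
  exact (((continuous_integral f.continuous).tendsto π).const_mul _).add_const _

lemma tendsto_mixture {t : ℕ → unitInterval} (ht : Tendsto t atTop (nhds 0))
    (π ν : ProbabilityMeasure Θ) : Tendsto (fun n => mixture (t n) π ν) atTop (nhds π) := by
  refine ProbabilityMeasure.tendsto_iff_forall_integral_tendsto.2 fun f => ?_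
  simp_rw [integral_mixture f.continuous]
  have ht' : Tendsto (fun n => (t n : ℝ)) atTop (nhds 0) :=
    (continuous_subtype_val.tendsto (0 : unitInterval)).comp ht
  simpa using ((ht'.const_sub 1).mul_const (∫ θ, f θ ∂(π : Measure Θ))).add
    (ht'.mul_const (∫ θ, f θ ∂(ν : Measure Θ)))

end Mixture

lemma sum_ne_bot {ι : Type*} (s : Finset ι) (f : ι → EReal) (h : ∀ i ∈ s, f i ≠ ⊥) :
    ∑ i ∈ s, f i ≠ ⊥ := by
  classical
  induction s using Finset.induction_on with
  | empty => simp
  | insert i s hi ih =>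
    rw [Finset.sum_insert hi, Ne, EReal.add_eq_bot_iff, not_or]
    exact ⟨h i (by simp), ih fun j hj => h j (by simp [hj])⟩

lemma sum_eq_top {ι : Type*} [Fintype ι] (f : ι → EReal) (h : ∀ i, f i ≠ ⊥) {i : ι}
    (hi : f i = ⊤) : ∑ j, f j = ⊤ := by
  classical
  rw [← Finset.add_sum_erase _ _ (Finset.mem_univ i), hi]
  exact EReal.top_add_of_ne_bot (sum_ne_bot _ _ fun j _ => h j)

lemma coe_sum_ereal {ι : Type*} (s : Finset ι) (f : ι → ℝ) :
    ((∑ i ∈ s, f i : ℝ) : EReal) = ∑ i ∈ s, (f i : EReal) :=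
  map_sum (⟨⟨Real.toEReal, EReal.coe_zero⟩, EReal.coe_add⟩ : ℝ →+ EReal) f s

lemma klTerm_ne_bot (a b c : ℝ) : klTerm a b c ≠ ⊥ := by
  unfold klTerm
  split_ifs
  · exact EReal.zero_ne_bot
  · exact top_ne_bot
  · exact EReal.coe_ne_bot _

section Risk

variable {Θ X Y : Type*} [Fintype X] [Fintype Y] {p : X → Y → Θ → ℝ} {q : X → Y → ℝ} {θ : Θ}

lemma risk_eq_top {x : X} {y : Y} (hp : p x y θ ≠ 0) (hq : q x y = 0) : risk p q θ = ⊤ :=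
  sum_eq_top _ (fun _ => sum_ne_bot _ _ fun _ _ => klTerm_ne_bot _ _ _) (i := x)
    (sum_eq_top _ (fun _ => klTerm_ne_bot _ _ _) (i := y) (by simp [klTerm, hp, hq]))

lemma risk_eq_logRisk (hnn : ∀ x y, 0 ≤ p x y θ) (hs : ∀ x y, p x y θ ≠ 0 → q x y ≠ 0) :
    risk p q θ = (logRisk p q θ : EReal) := by
  have key : ∀ x y, klTerm (p x y θ) (p x y θ / ∑ y' : Y, p x y' θ) (q x y)
      = ((negEnt (p x y θ) - p x y θ * Real.log (∑ y' : Y, p x y' θ)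
        - p x y θ * Real.log (q x y) : ℝ) : EReal) := by
    intro x y
    by_cases h : p x y θ = 0
    · simp [klTerm, negEnt, h]
    have hS : ∑ y' : Y, p x y' θ ≠ 0 :=
      ((lt_of_le_of_ne (hnn x y) (Ne.symm h)).trans_le
        (Finset.single_le_sum (fun y _ => hnn x y) (Finset.mem_univ y))).ne'
    rw [klTerm, if_neg h, if_neg (hs x y h), Real.log_div (div_ne_zero h hS) (hs x y h),
      Real.log_div h hS, negEnt]
    congr 1
    ring
  simp_rw [risk, key, ← coe_sum_ereal]
  congr 1
  simp only [logRisk, entGap, negEnt, Finset.sum_sub_distrib, Finset.sum_mul]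

end Risk

section Continuity

variable {Θ X Y : Type*} [TopologicalSpace Θ] [Fintype X] [Fintype Y] {p : X → Y → Θ → ℝ}

lemma continuous_entGap (hc : ∀ x y, Continuous (p x y)) : Continuous (entGap p) :=
  (continuous_finsetSum _ fun x _ => continuous_finsetSum _ fun y _ =>
    continuous_negEnt.comp (hc x y)).sub
  (continuous_finsetSum _ fun x _ => continuous_negEnt.comp
    (continuous_finsetSum _ fun y _ => hc x y))

lemma continuous_logRisk (hc : ∀ x y, Continuous (p x y)) (q : X → Y → ℝ) :
    Continuous (logRisk p q) :=
  (continuous_entGap hc).sub (continuous_finsetSum _ fun x _ => continuous_finsetSum _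
    fun y _ => (hc x y).mul_const _)

end Continuity

/-- The prior `π` gives positive marginal mass to every pair that some parameter charges. -/
def FullSupport {Θ X Y : Type*} [MeasurableSpace Θ] (p : X → Y → Θ → ℝ)
    (π : ProbabilityMeasure Θ) : Prop :=
  ∀ x y θ, p x y θ ≠ 0 → 0 < pMix p π x y

lemma pMix_nonneg {Θ X Y : Type*} [MeasurableSpace Θ] {p : X → Y → Θ → ℝ}
    (hnn : ∀ x y θ, 0 ≤ p x y θ) (π : ProbabilityMeasure Θ) (x : X) (y : Y) :
    0 ≤ pMix p π x y := integral_nonneg (hnn x y)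

section PredictiveDensity

variable {Θ X Y : Type*} [MeasurableSpace Θ] [Fintype Y] {p : X → Y → Θ → ℝ}

lemma condPred_nonneg (hnn : ∀ x y θ, 0 ≤ p x y θ) (π : ProbabilityMeasure Θ) (x : X) (y : Y) :
    0 ≤ condPred (pMix p π) x y :=
  div_nonneg (pMix_nonneg hnn π x y) (Finset.sum_nonneg fun y _ => pMix_nonneg hnn π x y)

lemma sum_condPred {π : ProbabilityMeasure Θ} {x : X} (h : 0 < ∑ y, pMix p π x y) :
    ∑ y, condPred (pMix p π) x y = 1 := by
  simp_rw [condPred, ← Finset.sum_div]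
  exact div_self h.ne'

lemma FullSupport.sum_pos (hnn : ∀ x y θ, 0 ≤ p x y θ)
    (hx : ∀ x : X, ∃ θ : Θ, 0 < ∑ y : Y, p x y θ) {π : ProbabilityMeasure Θ}
    (hπ : FullSupport p π) (x : X) : 0 < ∑ y, pMix p π x y := by
  obtain ⟨θ, hθ⟩ := hx x
  obtain ⟨y, -, hy⟩ := Finset.exists_ne_zero_of_sum_ne_zero hθ.ne'
  exact (hπ x y θ hy).trans_le
    (Finset.single_le_sum (fun y _ => pMix_nonneg hnn π x y) (Finset.mem_univ y))

end PredictiveDensity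

section MixtureDensity

variable {Θ X Y : Type*} [MetricSpace Θ] [CompactSpace Θ] [MeasurableSpace Θ] [BorelSpace Θ]
  {p : X → Y → Θ → ℝ}

lemma continuous_pMix (hc : ∀ x y, Continuous (p x y)) (x : X) (y : Y) :
    Continuous fun π => pMix p π x y := continuous_integral (hc x y)

lemma pMix_mixture (hc : ∀ x y, Continuous (p x y)) (t : unitInterval)
    (π ν : ProbabilityMeasure Θ) (x : X) (y : Y) :
    pMix p (mixture t π ν) x y = (1 - t) * pMix p π x y + t * pMix p ν x y :=
  integral_mixture (hc x y) t π ν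

lemma FullSupport.mixture_of_pos_left (hc : ∀ x y, Continuous (p x y))
    (hnn : ∀ x y θ, 0 ≤ p x y θ) {t : unitInterval} {π : ProbabilityMeasure Θ}
    (hπ : FullSupport p π) (ht : (t : ℝ) < 1) (ν : ProbabilityMeasure Θ) :
    FullSupport p (mixture t π ν) := fun x y θ h => by
  rw [pMix_mixture hc]
  exact add_pos_of_pos_of_nonneg (mul_pos (sub_pos.2 ht) (hπ x y θ h))
    (mul_nonneg t.2.1 (pMix_nonneg hnn ν x y))

lemma FullSupport.mixture_of_pos_right (hc : ∀ x y, Continuous (p x y))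
    (hnn : ∀ x y θ, 0 ≤ p x y θ) {t : unitInterval} {ν : ProbabilityMeasure Θ}
    (hν : FullSupport p ν) (ht : 0 < (t : ℝ)) (π : ProbabilityMeasure Θ) :
    FullSupport p (mixture t π ν) := fun x y θ h => by
  rw [pMix_mixture hc]
  exact add_pos_of_nonneg_of_pos (mul_nonneg (sub_nonneg.2 t.2.2) (pMix_nonneg hnn π x y))
    (mul_pos ht (hν x y θ h))

end MixtureDensity

section Functional

variable {Θ X Y : Type*} [MetricSpace Θ] [CompactSpace Θ] [MeasurableSpace Θ] [BorelSpace Θ]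
  [Fintype X] [Fintype Y] {p : X → Y → Θ → ℝ}

lemma integral_logRisk (hc : ∀ x y, Continuous (p x y)) (q : X → Y → ℝ)
    (π : ProbabilityMeasure Θ) :
    ∫ θ, logRisk p q θ ∂(π : Measure Θ)
      = (∫ θ, entGap p θ ∂(π : Measure Θ)) - ∑ x, ∑ y, pMix p π x y * Real.log (q x y) := by
  have hi : ∀ x y, Integrable (fun θ => p x y θ * Real.log (q x y)) (π : Measure Θ) :=
    fun x y => integrable_of_continuous ((hc x y).mul_const _) π
  unfold logRisk
  rw [integral_sub (integrable_of_continuous (continuous_entGap hc) π)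
    (integrable_finsetSum _ fun x _ => integrable_finsetSum _ fun y _ => hi x y),
    integral_finsetSum _ fun x _ => integrable_finsetSum _ fun y _ => hi x y]
  simp_rw [integral_finsetSum _ fun y _ => hi _ y, integral_mul_const, pMix]

lemma condMutualInfo_eq (hc : ∀ x y, Continuous (p x y)) (π : ProbabilityMeasure Θ) :
    condMutualInfo p π = (∫ θ, entGap p θ ∂(π : Measure Θ))
      - ∑ x, ∑ y, negEnt (pMix p π x y) + ∑ x, negEnt (∑ y, pMix p π x y) := by
  unfold entGap
  rw [integral_sub]
  · rw [condMutualInfo]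
    ring
  · exact integrable_of_continuous (continuous_finsetSum _ fun x _ => continuous_finsetSum _
      fun y _ => continuous_negEnt.comp (hc x y)) π
  · exact integrable_of_continuous (continuous_finsetSum _ fun x _ => continuous_negEnt.comp
      (continuous_finsetSum _ fun y _ => hc x y)) π

lemma continuous_condMutualInfo (hc : ∀ x y, Continuous (p x y)) :
    Continuous (condMutualInfo p) := by
  rw [funext (condMutualInfo_eq hc)]
  exact ((continuous_integral (continuous_entGap hc)).sub
    (continuous_finsetSum _ fun x _ => continuous_finsetSum _ fun y _ =>
      continuous_negEnt.comp (continuous_pMix hc x y))).add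
    (continuous_finsetSum _ fun x _ => continuous_negEnt.comp
      (continuous_finsetSum _ fun y _ => continuous_pMix hc x y))

lemma condMutualInfo_le_integral_logRisk (hc : ∀ x y, Continuous (p x y))
    (hnn : ∀ x y θ, 0 ≤ p x y θ) {q : X → Y → ℝ} (hq : ∀ x y, 0 ≤ q x y)
    (hq1 : ∀ x, ∑ y, q x y ≤ 1) (hs : ∀ x y θ, p x y θ ≠ 0 → q x y ≠ 0)
    (π : ProbabilityMeasure Θ) :
    condMutualInfo p π ≤ ∫ θ, logRisk p q θ ∂(π : Measure Θ) := by
  rw [integral_logRisk hc, condMutualInfo_eq hc]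
  have h : ∀ x, _ := fun x => sum_mul_log_add_negEnt_sum_le (pMix p π x) (q x)
    (pMix_nonneg hnn π x) (hq x) (hq1 x) fun y hy h0 => hy <| by
      have : p x y = 0 := funext fun θ => not_not.1 fun h => hs x y θ h h0
      simp [pMix, this]
  have := Finset.sum_le_sum fun x (_ : x ∈ Finset.univ) => h x
  rw [Finset.sum_add_distrib] at this
  linarith

lemma condMutualInfo_eq_integral_logRisk (hc : ∀ x y, Continuous (p x y))
    {π : ProbabilityMeasure Θ} (hpos : ∀ x, 0 < ∑ y, pMix p π x y) :
    condMutualInfo p π = ∫ θ, logRisk p (condPred (pMix p π)) θ ∂(π : Measure Θ) := by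
  have key : ∀ x y, pMix p π x y * Real.log (condPred (pMix p π) x y)
      = negEnt (pMix p π x y) - pMix p π x y * Real.log (∑ y, pMix p π x y) := by
    intro x y
    by_cases h : pMix p π x y = 0
    · simp [h, negEnt]
    rw [condPred, Real.log_div h (hpos x).ne', negEnt]
    ring
  rw [integral_logRisk hc, condMutualInfo_eq hc]
  simp_rw [key, Finset.sum_sub_distrib, ← Finset.sum_mul]
  unfold negEnt
  ring


noncomputable def smallWeight (n : ℕ) : unitInterval :=
  ⟨1 / ((n : ℝ) + 2), by positivity, by
    rw [div_le_one (by positivity)]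
    linarith [(Nat.cast_nonneg n : (0 : ℝ) ≤ n)]⟩

lemma smallWeight_pos (n : ℕ) : 0 < (smallWeight n : ℝ) := by
  change 0 < 1 / ((n : ℝ) + 2)
  positivity

lemma smallWeight_lt_one (n : ℕ) : (smallWeight n : ℝ) < 1 := by
  change 1 / ((n : ℝ) + 2) < 1
  rw [div_lt_one (by positivity)]
  linarith [(Nat.cast_nonneg n : (0 : ℝ) ≤ n)]

lemma tendsto_smallWeight : Tendsto smallWeight atTop (nhds 0) :=
  tendsto_subtype_rng.2 <| tendsto_const_nhds.div_atTop
    (tendsto_atTop_add_const_right _ _ tendsto_natCast_atTop_atTop)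

lemma integral_diracProba {f : Θ → ℝ} (θ : Θ) :
    ∫ θ', f θ' ∂(diracProba θ : Measure Θ) = f θ := integral_dirac f θ

lemma exists_fullSupport [Nonempty Θ] (hc : ∀ x y, Continuous (p x y))
    (hnn : ∀ x y θ, 0 ≤ p x y θ) : ∃ μ : ProbabilityMeasure Θ, FullSupport p μ := by
  classical
  suffices h : ∀ s : Finset (X × Y), ∃ μ : ProbabilityMeasure Θ,
      ∀ z ∈ s, ∀ θ, p z.1 z.2 θ ≠ 0 → 0 < pMix p μ z.1 z.2 by
    obtain ⟨μ, hμ⟩ := h Finset.univ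
    exact ⟨μ, fun x y θ => hμ (x, y) (Finset.mem_univ _) θ⟩
  intro s
  induction s using Finset.induction_on with
  | empty => exact ⟨diracProba (Classical.arbitrary Θ), by simp⟩
  | insert z s hz ih =>
    obtain ⟨μ, hμ⟩ := ih
    by_cases h : ∃ θ, p z.1 z.2 θ ≠ 0
    · obtain ⟨θ₀, hθ₀⟩ := h
      refine ⟨mixture ⟨1 / 2, by norm_num, by norm_num⟩ μ (diracProba θ₀), fun w hw θ hθ => ?_⟩
      have h0 := pMix_nonneg hnn μ w.1 w.2
      have h1 := hnn w.1 w.2 θ₀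
      rw [pMix_mixture hc, pMix, pMix, integral_diracProba, ← pMix]
      norm_num
      rcases Finset.mem_insert.1 hw with rfl | hw
      · have := lt_of_le_of_ne h1 (Ne.symm hθ₀)
        linarith
      · have := hμ w hw θ hθ
        linarith
    · refine ⟨μ, fun w hw θ hθ => ?_⟩
      rcases Finset.mem_insert.1 hw with rfl | hw
      · exact absurd ⟨θ, hθ⟩ h
      · exact hμ w hw θ hθ

/-- First-order optimality: if mixing `ν` into `π` does not increase the conditional mutual
information, then the `ν`-average risk of the predictive density of `π` is at most that of `π`. -/
lemma integral_logRisk_le_of_forall_mixture_le (hc : ∀ x y, Continuous (p x y))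
    (hnn : ∀ x y θ, 0 ≤ p x y θ) (hx : ∀ x : X, ∃ θ : Θ, 0 < ∑ y : Y, p x y θ)
    {π ν : ProbabilityMeasure Θ} (hπ : FullSupport p π)
    (hmax : ∀ ε : unitInterval, condMutualInfo p (mixture ε π ν) ≤ condMutualInfo p π) :
    ∫ θ, logRisk p (condPred (pMix p π)) θ ∂(ν : Measure Θ) ≤ condMutualInfo p π := by
  set ρ : ℕ → ProbabilityMeasure Θ := fun n => mixture (smallWeight n) π ν with hρ
  have hρs : ∀ n, FullSupport p (ρ n) := fun n =>
    hπ.mixture_of_pos_left hc hnn (smallWeight_lt_one n) ν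
  have hle : ∀ n, ∫ θ, logRisk p (condPred (pMix p (ρ n))) θ ∂(ν : Measure Θ)
      ≤ condMutualInfo p π := by
    intro n
    have h1 := hmax (smallWeight n)
    have hpos := (hρs n).sum_pos hnn hx
    rw [condMutualInfo_eq_integral_logRisk hc hpos, integral_mixture (continuous_logRisk hc _)]
      at h1
    have h2 := condMutualInfo_le_integral_logRisk hc hnn (condPred_nonneg hnn (ρ n))
      (fun x => (sum_condPred (hpos x)).le)
      (fun x y θ h => (div_pos (hρs n x y θ h) (hpos x)).ne') π
    have h3 := mul_le_mul_of_nonneg_left h2 (sub_nonneg.2 (smallWeight_lt_one n).le)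
    refine le_of_mul_le_mul_left ?_ (smallWeight_pos n)
    linarith
  suffices h : Tendsto (fun n => ∫ θ, logRisk p (condPred (pMix p (ρ n))) θ ∂(ν : Measure Θ)) atTop
      (nhds (∫ θ, logRisk p (condPred (pMix p π)) θ ∂(ν : Measure Θ))) from le_of_tendsto' h hle
  simp_rw [integral_logRisk hc]
  refine (tendsto_finsetSum _ fun x _ => tendsto_finsetSum _ fun y _ => ?_).const_sub _
  by_cases h : ∃ θ, p x y θ ≠ 0
  · obtain ⟨θ, hθ⟩ := h
    have hm : ∀ y, Tendsto (fun n => pMix p (ρ n) x y) atTop (nhds (pMix p π x y)) := fun y =>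
      ((continuous_pMix hc x y).tendsto π).comp (tendsto_mixture tendsto_smallWeight π ν)
    have hpos := hπ.sum_pos hnn hx x
    exact (((hm y).div (tendsto_finsetSum _ fun y _ => hm y) hpos.ne').log
      (div_pos (hπ x y θ hθ) hpos).ne').const_mul _
  · have : p x y = 0 := funext fun θ => not_not.1 fun h' => h ⟨θ, h'⟩
    simp [pMix, this]

/-- The risk bound satisfied by the predictive density of a prior maximizing the conditional
mutual information among the priors having `μ` as a component of weight `t`. -/
lemma logRisk_condPred_le (hc : ∀ x y, Continuous (p x y))
    (hnn : ∀ x y θ, 0 ≤ p x y θ) (hx : ∀ x : X, ∃ θ : Θ, 0 < ∑ y : Y, p x y θ)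
    {π μ : ProbabilityMeasure Θ} (hμ : FullSupport p μ) {t : unitInterval}
    (ht : 0 < (t : ℝ)) (ht1 : (t : ℝ) < 1)
    (hmax : ∀ ν, condMutualInfo p (mixture t ν μ) ≤ condMutualInfo p (mixture t π μ)) (θ : Θ) :
    logRisk p (condPred (pMix p (mixture t π μ))) θ
      ≤ (condMutualInfo p (mixture t π μ) - t * condMutualInfo p μ) / (1 - t) := by
  have hP : FullSupport p (mixture t π μ) := hμ.mixture_of_pos_right hc hnn ht π
  have hpos := hP.sum_pos hnn hx
  have h1 := integral_logRisk_le_of_forall_mixture_le hc hnn hx hP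
    (ν := mixture t (diracProba θ) μ) fun ε => by
      convert hmax (mixture ε π (diracProba θ)) using 1
      have hm : pMix p (mixture ε (mixture t π μ) (mixture t (diracProba θ) μ))
          = pMix p (mixture t (mixture ε π (diracProba θ)) μ) := by
        ext x y
        simp only [pMix_mixture hc]
        ring
      rw [condMutualInfo_eq hc, condMutualInfo_eq hc, hm]
      simp only [integral_mixture (continuous_entGap hc)]
      ring
  rw [integral_mixture (continuous_logRisk hc _), integral_diracProba] at h1
  have h2 := condMutualInfo_le_integral_logRisk hc hnn (condPred_nonneg hnn (mixture t π μ))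
    (fun x => (sum_condPred (hpos x)).le) (fun x y θ h => (div_pos (hP x y θ h) (hpos x)).ne') μ
  have h3 := mul_le_mul_of_nonneg_left h2 ht.le
  rw [le_div_iff₀ (sub_pos.2 ht1)]
  linarith

end Functional

/-- Lower semicontinuity of the risk along a convergent sequence of predictive densities. -/
lemma logRisk_le_of_tendsto {Θ X Y : Type*} [Fintype X] [Fintype Y] {p : X → Y → Θ → ℝ} {θ : Θ}
    (hnn : ∀ x y, 0 ≤ p x y θ) {q : ℕ → X → Y → ℝ} {q' : X → Y → ℝ}
    (hq0 : ∀ n x y, 0 ≤ q n x y) (hq1 : ∀ n x y, q n x y ≤ 1)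
    (hs : ∀ n x y, p x y θ ≠ 0 → q n x y ≠ 0)
    (hq : ∀ x y, Tendsto (fun n => q n x y) atTop (nhds (q' x y)))
    {C : ℕ → ℝ} {c : ℝ} (hC : Tendsto C atTop (nhds c)) (hle : ∀ n, logRisk p (q n) θ ≤ C n) :
    (∀ x y, p x y θ ≠ 0 → q' x y ≠ 0) ∧ logRisk p q' θ ≤ c := by
  have hs' : ∀ x y, p x y θ ≠ 0 → q' x y ≠ 0 := by
    intro x y h
    have h0 : 0 < p x y θ := lt_of_le_of_ne (hnn x y) (Ne.symm h)
    refine ((Real.exp_pos (-((c + 1 - entGap p θ) / p x y θ))).trans_le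
      (ge_of_tendsto (hq x y) ?_)).ne'
    filter_upwards [hC.eventually_le_const (lt_add_one c)] with n hn
    have hterm : ∀ x y, 0 ≤ -(p x y θ * Real.log (q n x y)) := fun x y =>
      neg_nonneg.2 (mul_nonpos_of_nonneg_of_nonpos (hnn x y)
        (Real.log_nonpos (hq0 n x y) (hq1 n x y)))
    have h1 : -(p x y θ * Real.log (q n x y))
        ≤ ∑ x, ∑ y, -(p x y θ * Real.log (q n x y)) :=
      (Finset.single_le_sum (fun y _ => hterm x y) (Finset.mem_univ y)).trans
        (Finset.single_le_sum (f := fun x => ∑ y, -(p x y θ * Real.log (q n x y)))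
          (fun x _ => Finset.sum_nonneg fun y _ => hterm x y) (Finset.mem_univ x))
    simp_rw [Finset.sum_neg_distrib] at h1
    have h2 := hle n
    rw [logRisk] at h2
    have hqpos : 0 < q n x y := lt_of_le_of_ne (hq0 n x y) (Ne.symm (hs n x y h))
    rw [← Real.le_log_iff_exp_le hqpos, neg_le, le_div_iff₀ h0]
    linarith
  refine ⟨hs', le_of_tendsto_of_tendsto' ?_ hC hle⟩
  refine (tendsto_finsetSum _ fun x _ => tendsto_finsetSum _ fun y _ => ?_).const_sub _
  by_cases h : p x y θ = 0
  · simp [h]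
  · exact ((hq x y).log (hs' x y h)).const_mul _

/-- Theorem 2, part 1: there is a weakly convergent sequence of priors whose limit maximizes
the conditional mutual information and whose Bayesian predictive densities converge pointwise
to a minimax predictive density. -/
theorem minimax_predictive_density_from_latent_information_prior
    {Θ X Y : Type*} [MetricSpace Θ] [CompactSpace Θ] [Nonempty Θ]
    [MeasurableSpace Θ] [BorelSpace Θ] [Fintype X] [Fintype Y]
    (p : X → Y → Θ → ℝ)
    (hc : ∀ x y, Continuous (p x y))
    (hnn : ∀ x y θ, 0 ≤ p x y θ)
    (hsum : ∀ θ : Θ, ∑ x : X, ∑ y : Y, p x y θ = 1)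
    (hx : ∀ x : X, ∃ θ : Θ, 0 < ∑ y : Y, p x y θ) :
    ∃ (πn : ℕ → ProbabilityMeasure Θ) (πlim : ProbabilityMeasure Θ),
      Tendsto πn atTop (nhds πlim) ∧
      (∀ (n : ℕ) (x : X), 0 < ∑ y : Y, pMix p (πn n) x y) ∧
      (∀ π : ProbabilityMeasure Θ, condMutualInfo p π ≤ condMutualInfo p πlim) ∧
      ∃ qstar : X → Y → ℝ,
        (∀ (x : X) (y : Y),
          Tendsto (fun n => pMix p (πn n) x y / ∑ y' : Y, pMix p (πn n) x y')
            atTop (nhds (qstar x y))) ∧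
        (⨆ θ : Θ, risk p qstar θ)
          = ⨅ q : {q : X → Y → ℝ // IsPredDensity q}, ⨆ θ : Θ, risk p q.val θ := by
  obtain ⟨μ, hμ⟩ := exists_fullSupport hc hnn
  have : Nonempty (ProbabilityMeasure Θ) := ⟨μ⟩
  have hmax : ∀ n, ∃ π : ProbabilityMeasure Θ, ∀ ν,
      condMutualInfo p (mixture (smallWeight n) ν μ)
        ≤ condMutualInfo p (mixture (smallWeight n) π μ) := by
    intro n
    obtain ⟨π, -, hπ⟩ := isCompact_univ.exists_isMaxOn Set.univ_nonempty
      ((continuous_condMutualInfo hc).comp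
        (continuous_mixture_left (smallWeight n) μ)).continuousOn
    exact ⟨π, fun ν => hπ (Set.mem_univ ν)⟩
  choose π hπ using hmax
  set P : ℕ → ProbabilityMeasure Θ := fun n => mixture (smallWeight n) (π n) μ with hP
  have hPs : ∀ n, FullSupport p (P n) := fun n =>
    hμ.mixture_of_pos_right hc hnn (smallWeight_pos n) (π n)
  have hpos : ∀ n x, 0 < ∑ y, pMix p (P n) x y := fun n => (hPs n).sum_pos hnn hx
  have hq0 : ∀ n x y, 0 ≤ condPred (pMix p (P n)) x y := fun n => condPred_nonneg hnn (P n)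
  have hq1 : ∀ n x y, condPred (pMix p (P n)) x y ≤ 1 := fun n x y =>
    (Finset.single_le_sum (fun y _ => hq0 n x y) (Finset.mem_univ y)).trans
      (sum_condPred (hpos n x)).le
  obtain ⟨⟨πlim, q⟩, -, φ, hφ, hlim⟩ :=
    ((isCompact_univ (X := ProbabilityMeasure Θ)).prod
      (isCompact_Icc (a := (0 : X → Y → ℝ)) (b := 1))).tendsto_subseq
      (x := fun n => (P n, condPred (pMix p (P n))))
      (fun n => ⟨Set.mem_univ _, hq0 n, hq1 n⟩)
  rw [nhds_prod_eq] at hlim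
  have hlimP : Tendsto (fun n => P (φ n)) atTop (nhds πlim) := tendsto_fst.comp hlim
  have hlimq : ∀ x y, Tendsto (fun n => condPred (pMix p (P (φ n))) x y) atTop (nhds (q x y)) :=
    fun x y => tendsto_pi_nhds.1 (tendsto_pi_nhds.1 (tendsto_snd.comp hlim) x) y
  have ht : Tendsto (fun n => smallWeight (φ n)) atTop (nhds 0) :=
    tendsto_smallWeight.comp hφ.tendsto_atTop
  have hI : Tendsto (fun n => condMutualInfo p (P (φ n))) atTop (nhds (condMutualInfo p πlim)) :=
    ((continuous_condMutualInfo hc).tendsto πlim).comp hlimP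
  have hbound : Tendsto (fun n => (condMutualInfo p (P (φ n))
      - smallWeight (φ n) * condMutualInfo p μ) / (1 - smallWeight (φ n))) atTop
      (nhds (condMutualInfo p πlim)) := by
    have ht' : Tendsto (fun n => (smallWeight (φ n) : ℝ)) atTop (nhds 0) :=
      (continuous_subtype_val.tendsto (0 : unitInterval)).comp ht
    have h := (hI.sub (ht'.mul_const (condMutualInfo p μ))).div (ht'.const_sub 1) (by simp)
    rwa [zero_mul, sub_zero, sub_zero, div_one] at h
  have hrisk : ∀ θ, (∀ x y, p x y θ ≠ 0 → q x y ≠ 0) ∧ logRisk p q θ ≤ condMutualInfo p πlim :=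
    fun θ => logRisk_le_of_tendsto (fun x y => hnn x y θ) (fun n => hq0 (φ n))
      (fun n => hq1 (φ n)) (fun n x y h => (div_pos (hPs (φ n) x y θ h) (hpos (φ n) x)).ne')
      hlimq hbound fun n => logRisk_condPred_le hc hnn hx hμ (smallWeight_pos _)
        (smallWeight_lt_one _) (hπ (φ n)) θ
  have hqd : IsPredDensity q := by
    refine ⟨fun x y => ⟨ge_of_tendsto' (hlimq x y) fun n => hq0 (φ n) x y,
      le_of_tendsto' (hlimq x y) fun n => hq1 (φ n) x y⟩, fun x => ?_⟩
    refine tendsto_nhds_unique (tendsto_finsetSum _ fun y _ => hlimq x y) ?_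
    simp_rw [fun n => sum_condPred (hpos (φ n) x)]
    exact tendsto_const_nhds
  refine ⟨fun n => P (φ n), πlim, hlimP, fun n => hpos (φ n), fun ν => ?_, q, hlimq,
    le_antisymm ?_ (iInf_le_of_le ⟨q, hqd⟩ le_rfl)⟩
  · exact le_of_tendsto_of_tendsto' (((continuous_condMutualInfo hc).tendsto ν).comp
      (tendsto_mixture ht ν μ)) hI fun n => hπ (φ n) ν
  · refine le_trans (b := ((condMutualInfo p πlim : ℝ) : EReal)) (iSup_le fun θ => ?_)
      (le_iInf fun r => ?_)
    · rw [risk_eq_logRisk (fun x y => hnn x y θ) (hrisk θ).1]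
      exact EReal.coe_le_coe_iff.2 (hrisk θ).2
    · obtain ⟨r, hr, hr1⟩ := r
      by_cases hs : ∀ x y θ, p x y θ ≠ 0 → r x y ≠ 0
      · obtain ⟨θ, hθ⟩ := exists_integral_le
          (integrable_of_continuous (continuous_logRisk hc r) πlim)
        refine le_iSup_of_le θ ?_
        rw [risk_eq_logRisk (fun x y => hnn x y θ) fun x y => hs x y θ]
        exact EReal.coe_le_coe_iff.2 ((condMutualInfo_le_integral_logRisk hc hnn
          (fun x y => (hr x y).1) (fun x => (hr1 x).le) hs πlim).trans hθ)
      · push Not at hs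
        obtain ⟨x, y, θ, hp, hr0⟩ := hs
        exact le_iSup_of_le θ (by rw [risk_eq_top hp hr0]; exact le_top)
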